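/- Let m be a positive integer and L, M, N ⊆ [m] with M ≠ [m]. Let D = (1+u^2)Δ_L + u^2(Δ_M^c + (u+u^2)Δ_N) ⊆ R^m. Then C_D has length |D| = (2^m − 2^{|M|})·2^{|L|+|N|} and |C_D| = 2^{2m+|L|}; in particular the number of v ∈ R^m with wt_L(c_D(v)) = 0 is 2^{m−|L|}. Moreover, for every v ∈ R^m the Lee weight wt_L(c_D(v)) is one of the six values 0, 3·2^{m+|L|+|N|−1}, (3·2^{m−1} − 2^{|M|})·2^{|L|+|N|}, 3·(2^m − 2^{|M|})·2^{|L|+|N|−1}, 2^{m+|L|+|N|}, (2^m − 2^{|M|})·2^{|L|+|N|}. -/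

import Mathlib

open Polynomial
open scoped Classical

noncomputable section

/-- The ring `R = Z₂[u]/⟨u³ - u⟩`. -/
abbrev Rng : Type := AdjoinRoot (X ^ 3 - X : Polynomial (ZMod 2))

/-- The image `u` of the variable in `R`. -/
def u : Rng := AdjoinRoot.root (X ^ 3 - X : Polynomial (ZMod 2))

/-- The natural inclusion of `Z₂` into `R`. -/
def toRng : ZMod 2 →+* Rng := AdjoinRoot.of _

lemma cubic_monic : (X ^ 3 - X : Polynomial (ZMod 2)).Monic :=
  Polynomial.monic_X_pow_sub (n := 3) (Polynomial.degree_X_le.trans_lt (by norm_num))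

/-- The Gray map `Φ : R → Z₂³`, `Φ(a + u b + u² d) = (a + b, b + d, d)`:
every element of `R` is represented by a unique polynomial of degree `< 3`,
whose coefficients are `a, b, d`. -/
def Phi (r : Rng) : Fin 3 → ZMod 2 :=
  ![(AdjoinRoot.modByMonicHom cubic_monic r).coeff 0 +
      (AdjoinRoot.modByMonicHom cubic_monic r).coeff 1,
    (AdjoinRoot.modByMonicHom cubic_monic r).coeff 1 +
      (AdjoinRoot.modByMonicHom cubic_monic r).coeff 2,
    (AdjoinRoot.modByMonicHom cubic_monic r).coeff 2]

/-- The support of a vector in `Z₂^m`. -/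
def supp {m : ℕ} (v : Fin m → ZMod 2) : Finset (Fin m) :=
  Finset.univ.filter (fun i => v i = 1)

/-- The simplicial complex `Δ_X` generated by `X ⊆ [m]`. -/
def Δ {m : ℕ} (X : Finset (Fin m)) : Finset (Fin m → ZMod 2) :=
  Finset.univ.filter (fun v => supp v ⊆ X)

/-- The Lee weight of a tuple over `R`: the Hamming weight of its coordinatewise Gray image. -/
def wtL {ι : Type} [Fintype ι] (x : ι → Rng) : ℕ :=
  ∑ i, (Finset.univ.filter (fun j : Fin 3 => Phi (x i) j ≠ 0)).card

/-- The defining set `D = (1+u²)D₁ + u²(D₂ + (u+u²)D₃) ⊆ R^m`. -/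
def Dset {m : ℕ} (D1 D2 D3 : Finset (Fin m → ZMod 2)) : Finset (Fin m → Rng) :=
  ((D1 ×ˢ D2) ×ˢ D3).image (fun t i =>
    (1 + u ^ 2) * toRng (t.1.1 i) +
      u ^ 2 * (toRng (t.1.2 i) + (u + u ^ 2) * toRng (t.2 i)))

/-- The codeword `c_D(v) = (v ⬝ d)_{d ∈ D}` of `C_D`. -/
def cD {m : ℕ} (D : Finset (Fin m → Rng)) (v : Fin m → Rng) : D → Rng :=
  fun d => ∑ i, v i * d.1 i



/-- The coordinate parametrisation of `R` by three bits. -/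
def rr (a b c : ZMod 2) : Rng :=
  (1 + u ^ 2) * toRng a + u ^ 2 * (toRng b + (u + u ^ 2) * toRng c)

lemma u_cube : u ^ 3 = u := by
  have h : AdjoinRoot.mk (X ^ 3 - X : Polynomial (ZMod 2)) (X ^ 3 - X) = 0 := AdjoinRoot.mk_self
  rw [map_sub, map_pow, AdjoinRoot.mk_X, sub_eq_zero] at h
  exact h

lemma two_rng : (2 : Rng) = 0 := by
  have h : toRng (2 : ZMod 2) = 0 := by
    have : (2 : ZMod 2) = 0 := by decide
    rw [this, map_zero]
  rw [← map_ofNat toRng 2]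
  exact h

lemma rr_eq_mk (a b c : ZMod 2) :
    rr a b c = AdjoinRoot.mk (X ^ 3 - X : Polynomial (ZMod 2))
      (C (a + b + c) * X ^ 2 + C c * X + C a) := by
  simp only [map_add, map_mul, map_pow, AdjoinRoot.mk_X, AdjoinRoot.mk_C]
  change rr a b c = (toRng a + toRng b + toRng c) * u ^ 2 + toRng c * u + toRng a
  unfold rr
  linear_combination (toRng c * (1 + u)) * u_cube

lemma coeff_rr (a b c : ZMod 2) :
    AdjoinRoot.modByMonicHom cubic_monic (rr a b c) = C (a + b + c) * X ^ 2 + C c * X + C a := by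
  rw [rr_eq_mk, AdjoinRoot.modByMonicHom_mk, Polynomial.modByMonic_eq_self_iff cubic_monic]
  have h : (X ^ 3 - X : Polynomial (ZMod 2)).degree = 3 := by compute_degree!
  rw [h]
  exact lt_of_le_of_lt Polynomial.degree_quadratic_le (by norm_num)

lemma Phi_rr (a b c : ZMod 2) : Phi (rr a b c) = ![a + c, a + b, a + b + c] := by
  unfold Phi
  rw [coeff_rr]
  simp only [coeff_add, coeff_C_mul, coeff_X_pow, coeff_X, coeff_C]
  norm_num
  revert a b c
  decide

lemma rr_inj {a b c a' b' c' : ZMod 2} (h : rr a b c = rr a' b' c') :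
    a = a' ∧ b = b' ∧ c = c' := by
  have h' := congrArg Phi h
  rw [Phi_rr, Phi_rr] at h'
  have h0 := congrFun h' 0
  have h1 := congrFun h' 1
  have h2 := congrFun h' 2
  simp at h0 h1 h2
  clear h h'
  revert a b c a' b' c'
  decide

lemma rr_surj (r : Rng) : ∃ a b c, rr a b c = r := by
  have h := AdjoinRoot.mk_leftInverse cubic_monic r
  set p := AdjoinRoot.modByMonicHom cubic_monic r with hp
  have hd : p.natDegree ≤ 2 := by
    obtain ⟨q, rfl⟩ := AdjoinRoot.mk_surjective r
    rw [hp, AdjoinRoot.modByMonicHom_mk]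
    have h3 : (X ^ 3 - X : Polynomial (ZMod 2)).natDegree = 3 := by compute_degree!
    have := Polynomial.natDegree_modByMonic_lt q cubic_monic (by
      intro h; rw [h] at h3; simp at h3)
    omega
  refine ⟨p.coeff 0, p.coeff 0 + p.coeff 1 + p.coeff 2, p.coeff 1, ?_⟩
  rw [rr_eq_mk, ← h]
  congr 1
  have e : p.coeff 0 + (p.coeff 0 + p.coeff 1 + p.coeff 2) + p.coeff 1 = p.coeff 2 := by
    generalize p.coeff 0 = x
    generalize p.coeff 1 = y
    generalize p.coeff 2 = z
    revert x y z
    decide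
  rw [e]
  exact (Polynomial.eq_quadratic_of_degree_le_two (Polynomial.natDegree_le_iff_degree_le.mp hd)).symm

lemma rr_mul (a b c a' b' c' : ZMod 2) :
    rr a b c * rr a' b' c' = rr (a * a') (b * b') (b * c' + c * b') := by
  unfold rr
  simp only [map_add, map_mul]
  have h4 : u ^ 4 = u ^ 2 := by linear_combination u * u_cube
  have h5 : u ^ 5 = u := by linear_combination (u ^ 2 + 1) * u_cube
  have h6 : u ^ 6 = u ^ 2 := by linear_combination (u ^ 3 + u) * u_cube
  have h7 : u ^ 7 = u := by linear_combination (u ^ 4 + u ^ 2 + 1) * u_cube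
  have h8 : u ^ 8 = u ^ 2 := by linear_combination (u ^ 5 + u ^ 3 + u) * u_cube
  have h3 := u_cube
  have h2 := two_rng
  generalize toRng a = A
  generalize toRng b = B
  generalize toRng c = E
  generalize toRng a' = A'
  generalize toRng b' = B'
  generalize toRng c' = E'
  grind

lemma rr_add (a b c a' b' c' : ZMod 2) :
    rr a b c + rr a' b' c' = rr (a + a') (b + b') (c + c') := by
  unfold rr
  simp only [map_add]
  ring

lemma rr_zero : rr 0 0 0 = 0 := by simp [rr]

lemma rr_sum {ι : Type} (s : Finset ι) (a b c : ι → ZMod 2) :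
    ∑ i ∈ s, rr (a i) (b i) (c i) = rr (∑ i ∈ s, a i) (∑ i ∈ s, b i) (∑ i ∈ s, c i) := by
  induction s using Finset.induction_on with
  | empty => simp [rr_zero]
  | insert i s hi ih => simp only [Finset.sum_insert hi, ih, rr_add]

/-- Vector version of `rr`. -/
def rv {m : ℕ} (t : ((Fin m → ZMod 2) × (Fin m → ZMod 2)) × (Fin m → ZMod 2)) : Fin m → Rng :=
  fun i => rr (t.1.1 i) (t.1.2 i) (t.2 i)

lemma rv_bij {m : ℕ} : Function.Bijective (rv (m := m)) := by
  constructor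
  · rintro ⟨⟨a, b⟩, c⟩ ⟨⟨a', b'⟩, c'⟩ h
    have h' := fun i => rr_inj (congrFun h i)
    have h1 : a = a' := funext fun i => (h' i).1
    have h2 : b = b' := funext fun i => (h' i).2.1
    have h3 : c = c' := funext fun i => (h' i).2.2
    rw [h1, h2, h3]
  · intro v
    choose a b c h using fun i => rr_surj (v i)
    exact ⟨((a, b), c), funext h⟩

/-- Dot product. -/
def dt {m : ℕ} (x t : Fin m → ZMod 2) : ZMod 2 := ∑ i, x i * t i

lemma rv_dot {m : ℕ} (x t : ((Fin m → ZMod 2) × (Fin m → ZMod 2)) × (Fin m → ZMod 2)) :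
    ∑ i, rv x i * rv t i =
      rr (dt x.1.1 t.1.1) (dt x.1.2 t.1.2) (dt x.1.2 t.2 + dt x.2 t.1.2) := by
  unfold rv dt
  simp only [rr_mul, rr_sum, Finset.sum_add_distrib]

/-- Nontrivial additive character of `Z₂`. -/
def ch (a : ZMod 2) : ℚ := if a = 0 then 1 else -1

lemma zmod2_cases (a : ZMod 2) : a = 0 ∨ a = 1 := by revert a; decide

lemma ch_add (a b : ZMod 2) : ch (a + b) = ch a * ch b := by
  have h : (1 + 1 : ZMod 2) = 0 := by decide
  rcases zmod2_cases a with rfl | rfl <;> rcases zmod2_cases b with rfl | rfl <;>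
    simp [ch, h]

lemma ch_zero : ch 0 = 1 := by simp [ch]

lemma ch_sum {ι : Type} (s : Finset ι) (f : ι → ZMod 2) :
    ch (∑ i ∈ s, f i) = ∏ i ∈ s, ch (f i) := by
  induction s using Finset.induction_on with
  | empty => simp [ch_zero]
  | insert i s hi ih => simp only [Finset.sum_insert hi, Finset.prod_insert hi, ih, ch_add]

lemma mem_Δ {m : ℕ} (S : Finset (Fin m)) (t : Fin m → ZMod 2) :
    t ∈ Δ S ↔ ∀ i, i ∉ S → t i = 0 := by
  simp only [Δ, supp, Finset.mem_filter, Finset.mem_univ, true_and, Finset.subset_iff]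
  refine forall_congr' fun i => ?_
  rcases zmod2_cases (t i) with h | h <;> simp [h]

lemma sum_Δ {m : ℕ} (S : Finset (Fin m)) (x : Fin m → ZMod 2) :
    ∑ t ∈ Δ S, ch (dt x t) = if ∀ i ∈ S, x i = 0 then 2 ^ S.card else 0 := by
  have hpi : Δ S = Fintype.piFinset (fun i => if i ∈ S then (Finset.univ : Finset (ZMod 2)) else {0}) := by
    ext t
    rw [mem_Δ, Fintype.mem_piFinset]
    refine forall_congr' fun i => ?_
    by_cases h : i ∈ S <;> simp [h]
  have huniv : (Finset.univ : Finset (ZMod 2)) = {0, 1} := by decide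
  rw [hpi]
  simp only [dt, ch_sum]
  rw [← Finset.prod_univ_sum (fun i => if i ∈ S then (Finset.univ : Finset (ZMod 2)) else {0})
    (fun i a => ch (x i * a))]
  have hf : ∀ i, ∑ a ∈ (if i ∈ S then (Finset.univ : Finset (ZMod 2)) else {0}), ch (x i * a)
      = if i ∈ S then (if x i = 0 then 2 else 0) else 1 := by
    intro i
    by_cases h : i ∈ S
    · simp only [h, if_true, huniv]
      rw [Finset.sum_pair (by decide)]
      rcases zmod2_cases (x i) with h | h <;> simp [h, ch]
      norm_num
    · simp [h, ch]
  simp only [hf]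
  rw [Finset.prod_ite_mem, Finset.univ_inter]
  split_ifs with h
  · rw [Finset.prod_congr rfl (fun i hi => if_pos (h i hi)), Finset.prod_const]
  · push Not at h
    obtain ⟨i, hi, hx⟩ := h
    exact Finset.prod_eq_zero hi (if_neg hx)

lemma card_Δ {m : ℕ} (S : Finset (Fin m)) : (Δ S).card = 2 ^ S.card := by
  have h := sum_Δ S 0
  simp [dt, ch_zero] at h
  exact_mod_cast h

/-- Character sum over the complement of `Δ M`. -/
def TT {m : ℕ} (M : Finset (Fin m)) (x : Fin m → ZMod 2) : ℚ :=
  (if x = 0 then 2 ^ m else 0) - (if ∀ i ∈ M, x i = 0 then 2 ^ M.card else 0)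

lemma sum_Δc {m : ℕ} (M : Finset (Fin m)) (x : Fin m → ZMod 2) :
    ∑ t ∈ (Δ M)ᶜ, ch (dt x t) = TT M x := by
  have h := Finset.sum_add_sum_compl (Δ M) (fun t => ch (dt x t))
  have hu : (Finset.univ : Finset (Fin m → ZMod 2)) = Δ Finset.univ := by
    ext t; simp [mem_Δ]
  rw [hu, sum_Δ, sum_Δ] at h
  have h0 : (∀ i ∈ (Finset.univ : Finset (Fin m)), x i = 0) ↔ x = 0 := by
    simp [funext_iff]
  simp only [h0, Finset.card_univ, Fintype.card_fin] at h
  unfold TT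
  linarith

lemma sum3 {α β γ : Type} (A : Finset α) (B : Finset β) (E : Finset γ)
    (f : α → ℚ) (g : β → ℚ) (h : γ → ℚ) :
    ∑ t ∈ (A ×ˢ B) ×ˢ E, f t.1.1 * g t.1.2 * h t.2 = (∑ a ∈ A, f a) * (∑ b ∈ B, g b) * ∑ c ∈ E, h c := by
  rw [Finset.sum_product]
  simp only [Finset.sum_product]
  rw [Finset.sum_mul_sum, Finset.sum_mul]
  refine Finset.sum_congr rfl fun a _ => ?_
  rw [Finset.sum_mul]
  refine Finset.sum_congr rfl fun b _ => ?_
  rw [Finset.mul_sum]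

lemma wt_single (r : Rng) :
    ((Finset.univ.filter (fun j : Fin 3 => Phi r j ≠ 0)).card : ℚ) =
      3 / 2 - (ch (Phi r 0) + ch (Phi r 1) + ch (Phi r 2)) / 2 := by
  rw [Finset.card_filter]
  push_cast
  rw [Fin.sum_univ_three]
  have key : ∀ a : ZMod 2, (if a ≠ 0 then (1 : ℚ) else 0) = 1 / 2 - ch a / 2 := by
    intro a
    rcases zmod2_cases a with rfl | rfl <;> simp [ch]
    norm_num
  rw [key, key, key]
  ring

/-- Indicator of vanishing on `S` times `2^|S|`. -/
def SS {m : ℕ} (S : Finset (Fin m)) (x : Fin m → ZMod 2) : ℚ :=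
  if ∀ i ∈ S, x i = 0 then 2 ^ S.card else 0

lemma Dset_eq {m : ℕ} (D1 D2 D3 : Finset (Fin m → ZMod 2)) :
    Dset D1 D2 D3 = ((D1 ×ˢ D2) ×ˢ D3).image rv := rfl

lemma dt_add {m : ℕ} (x y t : Fin m → ZMod 2) : dt (x + y) t = dt x t + dt y t := by
  simp [dt, add_mul, Finset.sum_add_distrib]

lemma dt_zero {m : ℕ} (t : Fin m → ZMod 2) : dt 0 t = 0 := by simp [dt]

lemma SS_zero {m : ℕ} (S : Finset (Fin m)) : SS S 0 = 2 ^ S.card := by simp [SS]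
lemma TT_zero {m : ℕ} (S : Finset (Fin m)) : TT S 0 = 2 ^ m - 2 ^ S.card := by simp [TT]

lemma card_D {m : ℕ} (L M N : Finset (Fin m)) :
    ((Dset (Δ L) ((Δ M)ᶜ) (Δ N)).card : ℚ) = (2 ^ m - 2 ^ M.card) * 2 ^ (L.card + N.card) := by
  have h := sum_Δc M 0
  simp [dt_zero, ch_zero, -Finset.card_compl, TT_zero] at h
  rw [Dset_eq, Finset.card_image_of_injective _ rv_bij.1]
  simp only [Finset.card_product, card_Δ]
  push_cast
  rw [h]
  ring

lemma wt_formula {m : ℕ} (L M N : Finset (Fin m))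
    (x y z : Fin m → ZMod 2) :
    (wtL (cD (Dset (Δ L) ((Δ M)ᶜ) (Δ N)) (rv ((x, y), z))) : ℚ) =
      3 / 2 * ((2 ^ m - 2 ^ M.card) * 2 ^ (L.card + N.card)) -
      SS L x * (TT M z * SS N y + TT M y * 2 ^ N.card + TT M (y + z) * SS N y) / 2 := by
  unfold wtL cD
  push_cast
  rw [Finset.sum_coe_sort (Dset (Δ L) ((Δ M)ᶜ) (Δ N)) (fun d =>
    ((Finset.univ.filter (fun j : Fin 3 => Phi (∑ i, rv ((x, y), z) i * d i) j ≠ 0)).card : ℚ))]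
  simp only [wt_single]
  rw [Finset.sum_sub_distrib, Finset.sum_const, nsmul_eq_mul, card_D, ← Finset.sum_div,
    Dset_eq, Finset.sum_image (fun a _ b _ h => rv_bij.1 h)]
  simp only [rv_dot, Phi_rr]
  have hch : ∀ t : ((Fin m → ZMod 2) × (Fin m → ZMod 2)) × (Fin m → ZMod 2),
      (ch (![dt x t.1.1 + (dt y t.2 + dt z t.1.2), dt x t.1.1 + dt y t.1.2,
          dt x t.1.1 + dt y t.1.2 + (dt y t.2 + dt z t.1.2)] 0) +
       ch (![dt x t.1.1 + (dt y t.2 + dt z t.1.2), dt x t.1.1 + dt y t.1.2,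
          dt x t.1.1 + dt y t.1.2 + (dt y t.2 + dt z t.1.2)] 1) +
       ch (![dt x t.1.1 + (dt y t.2 + dt z t.1.2), dt x t.1.1 + dt y t.1.2,
          dt x t.1.1 + dt y t.1.2 + (dt y t.2 + dt z t.1.2)] 2)) =
      ch (dt x t.1.1) * ch (dt z t.1.2) * ch (dt y t.2) +
      ch (dt x t.1.1) * ch (dt y t.1.2) * ch (dt 0 t.2) +
      ch (dt x t.1.1) * ch (dt (y + z) t.1.2) * ch (dt y t.2) := by
    intro t
    simp [ch_add, dt_add, dt_zero, ch_zero]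
    ring
  simp only [hch, Finset.sum_add_distrib]
  rw [sum3 _ _ _ (fun t => ch (dt x t)) (fun t => ch (dt z t)) (fun t => ch (dt y t)),
    sum3 _ _ _ (fun t => ch (dt x t)) (fun t => ch (dt y t)) (fun t => ch (dt 0 t)),
    sum3 _ _ _ (fun t => ch (dt x t)) (fun t => ch (dt (y + z) t)) (fun t => ch (dt y t))]
  simp only [sum_Δc, sum_Δ]
  have h0 : (if ∀ i ∈ N, (0 : Fin m → ZMod 2) i = 0 then (2 : ℚ) ^ N.card else 0) = 2 ^ N.card :=
    if_pos fun _ _ => rfl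
  rw [h0]
  unfold SS
  ring

lemma add_eq_zero_iff2 {m : ℕ} (y z : Fin m → ZMod 2) : y + z = 0 ↔ y = z := by
  constructor
  · intro h
    funext i
    have := congrFun h i
    simp only [Pi.add_apply, Pi.zero_apply] at this
    generalize y i = a at *
    generalize z i = b at *
    revert a b; decide
  · rintro rfl
    funext i
    simp only [Pi.add_apply, Pi.zero_apply]
    generalize y i = a
    revert a; decide

lemma pow_M_lt {m : ℕ} (M : Finset (Fin m)) (hM : M ≠ Finset.univ) :
    (2 : ℚ) ^ M.card < 2 ^ m := by
  have h : M.card < m := by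
    simpa using Finset.card_lt_univ_of_notMem (s := M)
      (x := (by
        exact Classical.choose (not_forall.mp (fun h => hM (Finset.eq_univ_iff_forall.mpr h)))))
      (Classical.choose_spec (not_forall.mp (fun h => hM (Finset.eq_univ_iff_forall.mpr h))))
  exact pow_lt_pow_right₀ (by norm_num) h

lemma TT_ne {m : ℕ} (M : Finset (Fin m)) {x : Fin m → ZMod 2} (h : x ≠ 0) : TT M x ≤ 0 := by
  unfold TT
  rw [if_neg h]
  split_ifs <;> simp

lemma wt_zero_iff {m : ℕ} (L M N : Finset (Fin m)) (hM : M ≠ Finset.univ)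
    (x y z : Fin m → ZMod 2) :
    wtL (cD (Dset (Δ L) ((Δ M)ᶜ) (Δ N)) (rv ((x, y), z))) = 0 ↔
      ((∀ i ∈ L, x i = 0) ∧ y = 0 ∧ z = 0) := by
  rw [← Nat.cast_eq_zero (R := ℚ), wt_formula]
  have hlt := pow_M_lt M hM
  have hP : (0 : ℚ) < 2 ^ m - 2 ^ M.card := by linarith
  have hl : (0 : ℚ) < 2 ^ L.card := by positivity
  have hn : (0 : ℚ) < 2 ^ N.card := by positivity
  have hln := mul_pos hl hn
  have hle : ∀ w : Fin m → ZMod 2, TT M w ≤ 2 ^ m - 2 ^ M.card := by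
    intro w
    by_cases h : w = 0
    · rw [h, TT_zero]
    · linarith [TT_ne M h]
  constructor
  · intro h
    by_cases hx : ∀ i ∈ L, x i = 0
    · refine ⟨hx, ?_⟩
      have hS : SS L x = 2 ^ L.card := if_pos hx
      rw [hS] at h
      have h' : 3 * (2 ^ m - 2 ^ M.card) * (2 : ℚ) ^ N.card =
        TT M z * SS N y + TT M y * 2 ^ N.card + TT M (y + z) * SS N y := by
        apply mul_left_cancel₀ hl.ne'
        rw [pow_add] at h
        linarith
      have hb : 0 ≤ SS N y ∧ SS N y ≤ 2 ^ N.card := by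
        unfold SS; split_ifs <;> simp
      have hm1 : ∀ w, TT M w * SS N y ≤ (2 ^ m - 2 ^ M.card) * 2 ^ N.card := fun w =>
        (mul_le_mul_of_nonneg_right (hle w) hb.1).trans (mul_le_mul_of_nonneg_left hb.2 hP.le)
      have hm2 : TT M y * 2 ^ N.card ≤ (2 ^ m - 2 ^ M.card) * 2 ^ N.card :=
        mul_le_mul_of_nonneg_right (hle y) hn.le
      have hpp := mul_pos hP hn
      constructor
      · by_contra hy
        have := mul_nonpos_of_nonpos_of_nonneg (TT_ne M hy) hn.le
        linarith [hm1 z, hm1 (y + z)]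
      · by_contra hz
        have := mul_nonpos_of_nonpos_of_nonneg (TT_ne M hz) hb.1
        linarith [hm1 (y + z)]
    · have hS : SS L x = 0 := if_neg hx
      rw [hS, pow_add] at h
      have := mul_pos hP hln
      linarith
  · rintro ⟨hx, rfl, rfl⟩
    have hS : SS L x = 2 ^ L.card := if_pos hx
    rw [hS, add_zero, TT_zero, SS_zero, pow_add]
    ring

lemma Phi_eq_zero (r : Rng) (h : ∀ j, Phi r j = 0) : r = 0 := by
  obtain ⟨a, b, c, rfl⟩ := rr_surj r
  rw [← rr_zero]
  have h0 := h 0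
  have h1 := h 1
  have h2 := h 2
  rw [Phi_rr] at h0 h1 h2
  simp at h0 h1 h2
  have : a = 0 ∧ b = 0 ∧ c = 0 := by
    clear h
    revert a b c; decide
  rw [this.1, this.2.1, this.2.2]

lemma wtL_eq_zero {ι : Type} [Fintype ι] (x : ι → Rng) : wtL x = 0 ↔ x = 0 := by
  unfold wtL
  rw [Finset.sum_eq_zero_iff]
  constructor
  · intro h
    funext i
    have := h i (Finset.mem_univ i)
    rw [Finset.card_eq_zero, Finset.filter_eq_empty_iff] at this
    exact Phi_eq_zero _ fun j => by simpa using this (Finset.mem_univ j)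
  · rintro rfl i -
    have : ∀ j, Phi 0 j = 0 := by
      intro j
      rw [← rr_zero, Phi_rr]
      fin_cases j <;> simp
    simp [this]

/-- The code map as an additive homomorphism. -/
def cHom {m : ℕ} (D : Finset (Fin m → Rng)) : (Fin m → Rng) →+ (D → Rng) where
  toFun := cD D
  map_zero' := by funext d; simp [cD]
  map_add' := by intro v w; funext d; simp [cD, add_mul, Finset.sum_add_distrib]

lemma card_ker {m : ℕ} (L M N : Finset (Fin m)) (hM : M ≠ Finset.univ) :
    Nat.card {v : Fin m → Rng | wtL (cD (Dset (Δ L) ((Δ M)ᶜ) (Δ N)) v) = 0}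
      = 2 ^ (m - L.card) := by
  have hset : {v : Fin m → Rng | wtL (cD (Dset (Δ L) ((Δ M)ᶜ) (Δ N)) v) = 0} =
      (fun x => rv ((x, 0), 0)) '' (↑(Δ Lᶜ) : Set (Fin m → ZMod 2)) := by
    ext v
    obtain ⟨⟨⟨x, y⟩, z⟩, rfl⟩ := rv_bij.2 v
    rw [Set.mem_setOf_eq, wt_zero_iff L M N hM]
    constructor
    · rintro ⟨h, rfl, rfl⟩
      refine ⟨x, ?_, rfl⟩
      rw [Finset.mem_coe, mem_Δ]
      simpa using h
    · rintro ⟨x', hx', h⟩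
      have := rv_bij.1 h
      simp only [Prod.mk.injEq] at this
      obtain ⟨⟨rfl, rfl⟩, rfl⟩ := this
      rw [Finset.mem_coe, mem_Δ] at hx'
      exact ⟨by simpa using hx', rfl, rfl⟩
  rw [hset, Nat.card_image_of_injective]
  · simp [card_Δ, Finset.card_compl]
  · intro a b h
    have := rv_bij.1 h
    simp only [Prod.mk.injEq] at this
    exact this.1.1

lemma card_all (m : ℕ) : Nat.card (Fin m → Rng) = 2 ^ (3 * m) := by
  rw [← Nat.card_congr (Equiv.ofBijective _ (rv_bij (m := m)))]
  simp [Nat.card_prod]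
  ring

lemma card_code {m : ℕ} (L M N : Finset (Fin m)) (hM : M ≠ Finset.univ) :
    Nat.card (Set.range (cD (Dset (Δ L) ((Δ M)ᶜ) (Δ N)))) = 2 ^ (2 * m + L.card) := by
  set D := Dset (Δ L) ((Δ M)ᶜ) (Δ N) with hD
  have h1 := AddSubgroup.card_eq_card_quotient_mul_card_addSubgroup (cHom D).ker
  rw [Nat.card_congr (QuotientAddGroup.quotientKerEquivRange (cHom D)).toEquiv, card_all] at h1
  have h2 : Nat.card (cHom D).ker = 2 ^ (m - L.card) := by
    rw [← card_ker L M N hM]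
    refine Nat.card_congr (Equiv.subtypeEquivRight fun v => ?_)
    rw [Set.mem_setOf_eq, wtL_eq_zero, AddMonoidHom.mem_ker]
    rfl
  have h3 : Nat.card (cHom D).range = Nat.card (Set.range (cD D)) := rfl
  rw [h2, h3] at h1
  have hL : L.card ≤ m := by simpa using Finset.card_le_univ L
  have h4 : 2 ^ (3 * m) = 2 ^ (2 * m + L.card) * 2 ^ (m - L.card) := by
    rw [← pow_add]; congr 1; omega
  rw [h4] at h1
  exact (Nat.eq_of_mul_eq_mul_right (by positivity) h1).symm

theorem lee_weight_distribution_LMcN (m : ℕ) (hm : 0 < m) (L M N : Finset (Fin m))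
    (hM : M ≠ Finset.univ)
    (D : Finset (Fin m → Rng)) (hD : D = Dset (Δ L) ((Δ M)ᶜ) (Δ N)) :
    ((D.card : ℤ) = (2 ^ m - 2 ^ M.card) * 2 ^ (L.card + N.card)) ∧
    Nat.card (Set.range (cD D)) = 2 ^ (2 * m + L.card) ∧
    Nat.card {v : Fin m → Rng | wtL (cD D v) = 0} = 2 ^ (m - L.card) ∧
    (∀ v : Fin m → Rng,
      (wtL (cD D v) : ℚ) = 0 ∨
      (wtL (cD D v) : ℚ) = 3 * 2 ^ ((m : ℤ) + L.card + N.card - 1) ∨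
      (wtL (cD D v) : ℚ) =
        (3 * 2 ^ ((m : ℤ) - 1) - 2 ^ (M.card : ℤ)) * 2 ^ ((L.card : ℤ) + N.card) ∨
      (wtL (cD D v) : ℚ) =
        3 * (2 ^ (m : ℤ) - 2 ^ (M.card : ℤ)) * 2 ^ ((L.card : ℤ) + N.card - 1) ∨
      (wtL (cD D v) : ℚ) = 2 ^ ((m : ℤ) + L.card + N.card) ∨
      (wtL (cD D v) : ℚ) =
        (2 ^ (m : ℤ) - 2 ^ (M.card : ℤ)) * 2 ^ ((L.card : ℤ) + N.card)) := by
  subst hD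
  refine ⟨?_, card_code L M N hM, card_ker L M N hM, ?_⟩
  · have := card_D L M N
    exact_mod_cast this
  intro v
  obtain ⟨⟨⟨x, y⟩, z⟩, rfl⟩ := rv_bij.2 v
  rw [wt_formula]
  have two : (2 : ℚ) ≠ 0 := by norm_num
  simp only [zpow_sub₀ two, zpow_add₀ two, zpow_natCast, zpow_one, pow_add]
  by_cases hx : ∀ i ∈ L, x i = 0
  swap
  · have hS : SS L x = 0 := if_neg hx
    rw [hS]
    right; right; right; left
    ring
  have hS : SS L x = 2 ^ L.card := if_pos hx
  rw [hS]
  have hQ : ∀ w : Fin m → ZMod 2, w ≠ 0 → TT M w =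
      if ∀ i ∈ M, w i = 0 then - 2 ^ M.card else 0 := by
    intro w hw
    unfold TT
    rw [if_neg hw]
    split_ifs <;> ring
  by_cases hy0 : y = 0
  · subst hy0
    rw [SS_zero, TT_zero, zero_add]
    by_cases hz : z = 0
    · subst hz
      rw [TT_zero]
      left; ring
    · rw [hQ z hz]
      split_ifs
      · right; right; right; right; left; ring
      · right; right; right; right; right; ring
  by_cases hy : ∀ i ∈ N, y i = 0
  swap
  · have hSy : SS N y = 0 := if_neg hy
    rw [hSy, hQ y hy0]
    split_ifs
    · right; right; left; ring
    · right; right; right; left; ring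
  have hSy : SS N y = 2 ^ N.card := if_pos hy
  rw [hSy]
  by_cases hz : z = 0
  · subst hz
    rw [TT_zero, add_zero, hQ y hy0]
    split_ifs
    · right; right; right; right; left; ring
    · right; right; right; right; right; ring
  by_cases hyz : y + z = 0
  · have : y = z := (add_eq_zero_iff2 y z).1 hyz
    subst this
    rw [hyz, TT_zero, hQ y hy0]
    split_ifs
    · right; right; right; right; left; ring
    · right; right; right; right; right; ring
  rw [hQ y hy0, hQ z hz, hQ _ hyz]
  by_cases ha : ∀ i ∈ M, y i = 0 <;> by_cases hb : ∀ i ∈ M, z i = 0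
  · have hc : ∀ i ∈ M, (y + z) i = 0 := fun i hi => by simp [ha i hi, hb i hi]
    rw [if_pos ha, if_pos hb, if_pos hc]
    right; left; ring
  · have hc : ¬ ∀ i ∈ M, (y + z) i = 0 := fun hc => hb fun i hi => by
      simpa [ha i hi] using hc i hi
    rw [if_pos ha, if_neg hb, if_neg hc]
    right; right; left; ring
  · have hc : ¬ ∀ i ∈ M, (y + z) i = 0 := fun hc => ha fun i hi => by
      simpa [hb i hi] using hc i hi
    rw [if_neg ha, if_pos hb, if_neg hc]
    right; right; left; ring
  · rw [if_neg ha, if_neg hb]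
    split_ifs
    · right; right; left; ring
    · right; right; right; left; ring


end
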